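/- Let B be a basis of V which is equivalent to a basis whose graph is a tree of type D_{m,k} for some m≥2, k≥1. If X={x₁,…,x_r}⊆B induces a cycle of length r≥5 in Gr(B), then span(X)∩V₀₀₀ is the one-dimensional subspace spanned by x₁+x₂+⋯+x_r. -/

import Mathlib

open scoped BigOperators

/-- A `ZMod 2`-valued bilinear form on `V`. -/
abbrev BForm (V : Type*) [AddCommGroup V] [Module (ZMod 2) V] :=
  V →ₗ[ZMod 2] V →ₗ[ZMod 2] ZMod 2

variable {V : Type*} [AddCommGroup V] [Module (ZMod 2) V]

/-- `g` is the transvection `τ_b : x ↦ x + Ω(x,b)·b` for some `b ∈ B`. -/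
def IsTransvection (Ω : BForm V) (B : Set V) (g : V ≃ₗ[ZMod 2] V) : Prop :=
  ∃ b ∈ B, ∀ x : V, g x = x + Ω x b • b

/-- The group `Γ_B` generated by the transvections `τ_b`, `b ∈ B`. -/
def Gamma (Ω : BForm V) (B : Set V) : Subgroup (V ≃ₗ[ZMod 2] V) :=
  Subgroup.closure {g | IsTransvection Ω B g}

/-- `x` and `y` lie in the same `Γ_B`-orbit. -/
def SameOrbit (Ω : BForm V) (B : Set V) (x y : V) : Prop :=
  ∃ g ∈ Gamma Ω B, g x = y

/-- The graph `Gr(X)` on vertex set `X`, with `b, b'` adjacent iff `Ω(b,b') = 1` or `Ω(b',b) = 1`. -/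
def Gr (Ω : BForm V) (X : Set V) : SimpleGraph X :=
  SimpleGraph.fromRel fun a b => Ω a.1 b.1 = 1

/-- One basic move: `B' = φ_{c,a}(B)`, replacing `c` by `c + a`. -/
def MoveRel (Ω : BForm V) (B B' : Set V) : Prop :=
  ∃ a c, a ∈ B ∧ c ∈ B ∧ a ≠ c ∧ Ω a c = 1 ∧ B' = insert (c + a) (B \ {c})

/-- `B` and `B'` are equivalent: related by a finite sequence of basic moves. -/
def EquivSets (Ω : BForm V) : Set V → Set V → Prop :=
  Relation.ReflTransGen (MoveRel Ω)

/-- The kernel `V₀` of the form `Ω`. -/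
def V0set (Ω : BForm V) : Set V := {x | ∀ v : V, Ω x v = 0}

/-- `Δ`, the `Γ_B`-orbit containing `B` (when `Gr(B)` is connected). -/
def Delta (Ω : BForm V) (B : Set V) : Set V :=
  {x | ∃ b ∈ B, SameOrbit Ω B b x}

/-- `V₀₀₀`: vectors of `V₀` of the form `x₁ + x₂` with `x₁, x₂ ∈ Δ`. -/
def V000set (Ω : BForm V) (B : Set V) : Set V :=
  {y | y ∈ V0set Ω ∧ ∃ x₁ ∈ Delta Ω B, ∃ x₂ ∈ Delta Ω B, y = x₁ + x₂}

/-- `U₀₀₀` for `U = span(B)`: vectors of `U₀` of the form `x₁ + x₂` with `x₁, x₂ ∈ Δ`. -/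
def U000set (Ω : BForm V) (B : Set V) : Set V :=
  {y | y ∈ Submodule.span (ZMod 2) B ∧ (∀ u ∈ Submodule.span (ZMod 2) B, Ω y u = 0) ∧
    ∃ x₁ ∈ Delta Ω B, ∃ x₂ ∈ Delta Ω B, y = x₁ + x₂}

/-- `x = x₁ + ⋯ + x_s` with all `x_i ∈ Δ` and `Ω(x_i, x_j) = 0`: a `Δ`-decomposition. -/
def HasDeltaDecomp (Ω : BForm V) (B : Set V) (x : V) (s : ℕ) : Prop :=
  1 ≤ s ∧ ∃ f : Fin s → V, (∀ i, f i ∈ Delta Ω B) ∧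
    (∀ i j, i ≠ j → Ω (f i) (f j) = 0) ∧ x = ∑ i, f i

/-- `d(x)`: minimal length of a `Δ`-decomposition of `x`. -/
noncomputable def dval (Ω : BForm V) (B : Set V) (x : V) : ℕ :=
  sInf {s | HasDeltaDecomp Ω B x s}

/-- `Q` is the quadratic form associated with `Ω` and `S` (`Q(b)=1` on `S`, polarization `Ω`). -/
def IsQuadForm (Ω : BForm V) (S : Set V) (Q : V → ZMod 2) : Prop :=
  (∀ b ∈ S, Q b = 1) ∧ ∀ u v : V, Q (u + v) = Q u + Q v + Ω u v

/-- The tree of type `D_{m,k}`: path `a₁ — ⋯ — a_m` with leaves `c₁, …, c_k` attached to `a_m`. -/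
def DmkGraph (m k : ℕ) : SimpleGraph (Fin m ⊕ Fin k) :=
  SimpleGraph.fromRel fun x y =>
    match x, y with
    | Sum.inl i, Sum.inl j => i.val + 1 = j.val
    | Sum.inl i, Sum.inr _ => i.val + 1 = m
    | _, _ => False

/-- The Dynkin tree `E₆`. -/
def E6Graph : SimpleGraph (Fin 6) :=
  SimpleGraph.fromRel fun i j => (i.val, j.val) ∈ [(0,1),(1,2),(2,3),(3,4),(2,5)]

/-- Two triangles sharing a common edge: four vertices, five edges. -/
def TwoTrianglesGraph : SimpleGraph (Fin 4) :=
  SimpleGraph.fromRel fun i j => (i.val, j.val) ∈ [(0,1),(0,2),(0,3),(1,2),(1,3)]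

/-- The cycle of length `n`. -/
def CycleGraph (n : ℕ) : SimpleGraph (Fin n) :=
  SimpleGraph.fromRel fun i j => j.val = (i.val + 1) % n

/-- Membership in the family `F`: type `D_{2,2}`, two triangles sharing an edge,
or a cycle of length at least `4`. -/
def InF {α : Type*} (G : SimpleGraph α) : Prop :=
  Nonempty (G ≃g DmkGraph 2 2) ∨ Nonempty (G ≃g TwoTrianglesGraph) ∨
    ∃ n, 4 ≤ n ∧ Nonempty (G ≃g CycleGraph n)

/-- `B` is equivalent to a set whose graph is a tree of type `D_{m,k}`. -/
def EquivToDmkTree (Ω : BForm V) (B : Set V) (m k : ℕ) : Prop :=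
  ∃ B' : Set V, EquivSets Ω B B' ∧ Nonempty (Gr Ω B' ≃g DmkGraph m k)

/-- `X` is equivalent to a set whose graph is `E₆`. -/
def EquivToE6 (Ω : BForm V) (X : Set V) : Prop :=
  ∃ X' : Set V, EquivSets Ω X X' ∧ Nonempty (Gr Ω X' ≃g E6Graph)

/-- Some subset of `B` is equivalent to a set whose graph is `E₆`. -/
def HasE6Subgraph (Ω : BForm V) (B : Set V) : Prop :=
  ∃ X ⊆ B, EquivToE6 Ω X

/-- `B` is a basis of `V` (as a set). -/
def IsBasisSet (B : Set V) : Prop :=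
  LinearIndependent (ZMod 2) (Subtype.val : B → V) ∧ Submodule.span (ZMod 2) B = ⊤

/-- `B` is equivalent to a set whose graph is a tree containing `E₆` as an induced subgraph. -/
def EquivToE6Tree (Ω : BForm V) (B : Set V) : Prop :=
  ∃ B' : Set V, EquivSets Ω B B' ∧ (Gr Ω B').IsTree ∧
    ∃ X ⊆ B', Nonempty (Gr Ω X ≃g E6Graph)

/-- `A` is a maximal complete subgraph (maximal clique) of `G`. -/
def IsMaxClique {α : Type*} (G : SimpleGraph α) (A : Set α) : Prop :=
  G.IsClique A ∧ ∀ A', G.IsClique A' → A ⊆ A' → A' = A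

/-- `u` is the indicator vector of a two-element subset of `ι`. -/
def IsEdgeVec {ι : Type*} [DecidableEq ι] (u : ι → ZMod 2) : Prop :=
  ∃ p q, p ≠ q ∧ u = Pi.single p 1 + Pi.single q 1

section EdgeVec

variable {ι : Type*} [DecidableEq ι] {u w : ι → ZMod 2}

theorem zmod_two_eq_zero_or_one (a : ZMod 2) : a = 0 ∨ a = 1 := by
  revert a; decide

theorem zmod_two_add_self {M : Type*} [AddCommGroup M] [Module (ZMod 2) M] (v : M) :
    v + v = 0 := by
  rw [← two_smul (ZMod 2) v, show (2 : ZMod 2) = 0 from rfl, zero_smul]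

theorem single_add_single_dotProduct [Fintype ι] (p q : ι) (w : ι → ZMod 2) :
    (Pi.single p 1 + Pi.single q 1) ⬝ᵥ w = w p + w q := by
  simp [add_dotProduct]

theorem IsEdgeVec.eq_of_ne (hu : IsEdgeVec u) {v v' : ι} (h : v ≠ v') (hv : u v = 1)
    (hv' : u v' = 1) : u = Pi.single v 1 + Pi.single v' 1 := by
  obtain ⟨p, q, hpq, rfl⟩ := hu
  simp only [Pi.add_apply, Pi.single_apply] at hv hv'
  by_cases h1 : v = p <;> by_cases h2 : v = q <;> by_cases h3 : v' = p <;>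
    by_cases h4 : v' = q <;> simp_all [add_comm]

theorem IsEdgeVec.exists_other (hu : IsEdgeVec u) {v : ι} (hv : u v = 1) :
    ∃ v', v ≠ v' ∧ u = Pi.single v 1 + Pi.single v' 1 := by
  obtain ⟨p, q, hpq, rfl⟩ := hu
  simp only [Pi.add_apply, Pi.single_apply] at hv
  by_cases h1 : v = p
  · exact ⟨q, h1 ▸ hpq, by rw [h1]⟩
  · by_cases h2 : v = q
    · exact ⟨p, h1, by rw [h2, add_comm]⟩
    · simp [h1, h2] at hv

theorem IsEdgeVec.exists_common [Fintype ι] (hu : IsEdgeVec u) (h : u ⬝ᵥ w = 1) :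
    ∃ v, u v = 1 ∧ w v = 1 := by
  obtain ⟨p, q, hpq, rfl⟩ := hu
  rw [single_add_single_dotProduct] at h
  rcases zmod_two_eq_zero_or_one (w p) with hp | hp
  · exact ⟨q, by simp [hpq.symm], by simpa [hp] using h⟩
  · exact ⟨p, by simp [hpq], hp⟩

theorem IsEdgeVec.eq_of_common [Fintype ι] (hu : IsEdgeVec u) (hw : IsEdgeVec w)
    (h : u ⬝ᵥ w = 0) {v : ι} (huv : u v = 1) (hwv : w v = 1) : u = w := by
  obtain ⟨v', hne, rfl⟩ := hu.exists_other huv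
  rw [single_add_single_dotProduct, hwv] at h
  refine (hw.eq_of_ne hne hwv ?_).symm
  rcases zmod_two_eq_zero_or_one (w v') with h' | h'
  · simp [h'] at h
  · exact h'

theorem IsEdgeVec.add [Fintype ι] (hu : IsEdgeVec u) (hw : IsEdgeVec w) (h : u ⬝ᵥ w = 1) :
    IsEdgeVec (u + w) := by
  obtain ⟨v, huv, hwv⟩ := hu.exists_common h
  obtain ⟨p, hp, rfl⟩ := hu.exists_other huv
  obtain ⟨q, hq, rfl⟩ := hw.exists_other hwv
  refine ⟨p, q, ?_, ?_⟩
  · rintro rfl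
    simp [hp, hp.symm] at h
  · rw [add_add_add_comm, zmod_two_add_self, zero_add]

theorem IsEdgeVec.card_le_of_add [Fintype ι] {r : ℕ} {v : Fin r → ι}
    (hv : Function.Injective v) (hu : IsEdgeVec u) (hw : IsEdgeVec w)
    (h : ∀ i, (u + w) (v i) = 1) : r ≤ 4 := by
  obtain ⟨p, q, -, rfl⟩ := hu
  obtain ⟨p', q', -, rfl⟩ := hw
  have hsub : Finset.univ.image v ⊆ {p, q, p', q'} := by
    intro z hz
    obtain ⟨i, -, rfl⟩ := Finset.mem_image.1 hz
    by_contra hn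
    simp only [Finset.mem_insert, Finset.mem_singleton, not_or] at hn
    simpa [Pi.single_apply, hn] using h i
  have := (Finset.card_le_card hsub).trans Finset.card_le_four
  rwa [Finset.card_image_of_injective _ hv, Finset.card_univ, Fintype.card_fin] at this

end EdgeVec

section Cycle

variable {ι : Type*} [DecidableEq ι] [Fintype ι] {n : ℕ} {u : Fin (n + 5) → ι → ZMod 2}

theorem fin_add_five_small_ne_zero (n : ℕ) : (1 : Fin (n + 5)) ≠ 0 ∧ (2 : Fin (n + 5)) ≠ 0 ∧
    (3 : Fin (n + 5)) ≠ 0 ∧ (4 : Fin (n + 5)) ≠ 0 := by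
  have key : ∀ c, c < n + 5 → c ≠ 0 → Fin.ofNat (n + 5) c ≠ 0 := by
    intro c hc hc0 h
    exact hc0 (by simpa [Fin.ext_iff, Nat.mod_eq_of_lt hc] using h)
  exact ⟨key 1 (by omega) (by omega), key 2 (by omega) (by omega), key 3 (by omega) (by omega),
    key 4 (by omega) (by omega)⟩

/-- The vectors of an induced cycle of length at least five in the line graph are the edges of
a cycle. -/
theorem exists_cycle_vertices (hu : ∀ i, IsEdgeVec (u i))
    (hadj : ∀ i j, u i ⬝ᵥ u j = 1 ↔ (j = i + 1 ∨ i = j + 1)) :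
    ∃ v : Fin (n + 5) → ι, Function.Injective v ∧
      ∀ i, u i = Pi.single (v (i - 1)) 1 + Pi.single (v i) 1 := by
  obtain ⟨h1, h2, h3, h4⟩ := fin_add_five_small_ne_zero n
  have e2 : (2 : Fin (n + 5)) = 1 + 1 := rfl
  have e3 : (3 : Fin (n + 5)) = 1 + 1 + 1 := rfl
  have e4 : (4 : Fin (n + 5)) = 1 + 1 + 1 + 1 := rfl
  rw [e2] at h2
  rw [e3] at h3
  rw [e4] at h4
  have huinj : Function.Injective u := by
    intro i j hij
    have ha := (hadj i (i + 1)).2 (Or.inl rfl)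
    have hb := (hadj i (i - 1)).2 (Or.inr (by abel))
    rw [hij, hadj] at ha hb
    rcases ha with ha | ha
    · exact add_right_cancel ha
    rcases hb with hb | hb
    · exfalso
      apply h4
      rw [ha, sub_eq_iff_eq_add] at hb
      simpa [add_assoc] using hb
    · rw [hb]; abel
  have hzero : ∀ i j, j ≠ i + 1 → i ≠ j + 1 → u i ⬝ᵥ u j = 0 := by
    intro i j hj hi
    rcases zmod_two_eq_zero_or_one (u i ⬝ᵥ u j) with h | h
    · exact h
    · rw [hadj] at h; tauto
  have hex : ∀ i, ∃ v, u i v = 1 ∧ u (i + 1) v = 1 := fun i =>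
    (hu i).exists_common ((hadj i (i + 1)).2 (Or.inl rfl))
  choose v hv hv' using hex
  have hshare : ∀ i j p, u i p = 1 → u j p = 1 → i = j ∨ j = i + 1 ∨ i = j + 1 := by
    intro i j p hi hj
    by_contra! hn
    exact hn.1 (huinj ((hu i).eq_of_common (hu j) (hzero i j hn.2.1 hn.2.2) hi hj))
  have hconsec : ∀ i, v i ≠ v (i + 1) := by
    intro i h
    rcases hshare i (i + 1 + 1) (v i) (hv i) (h ▸ hv' (i + 1)) with h | h | h
    · exact h2 (by simpa [add_assoc] using h)
    · simp at h
    · exact h3 (by simpa [add_assoc] using h)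
  refine ⟨v, ?_, fun i => ?_⟩
  · intro i j hij
    rcases hshare i j (v i) (hv i) (hij ▸ hv j) with h | rfl | rfl
    · exact h
    · exact absurd hij (hconsec i)
    · exact absurd hij.symm (hconsec j)
  · have hi : i - 1 + 1 = i := by abel
    have ha := hconsec (i - 1)
    have hb := hv' (i - 1)
    rw [hi] at ha hb
    exact (hu i).eq_of_ne ha hb (hv i)

end Cycle

/-- `π` realizes `Ω` as the pull-back of the dot product, with `B` mapped to indicator vectors of
two-element sets. -/
def IsEdgeRep {ι : Type*} [Fintype ι] [DecidableEq ι] (Ω : BForm V) (B : Set V)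
    (π : V →ₗ[ZMod 2] (ι → ZMod 2)) : Prop :=
  (∀ x y, Ω x y = π x ⬝ᵥ π y) ∧ ∀ b ∈ B, IsEdgeVec (π b)

/-- The edges of a path of length `m + 1` with the last edge repeated `k` times. -/
def dmkEdge (m k : ℕ) : Fin m ⊕ Fin k → Fin (m + 2) → ZMod 2 :=
  Sum.elim
    (fun i => Pi.single ⟨i, by omega⟩ 1 + Pi.single ⟨i + 1, by omega⟩ 1)
    (fun _ => Pi.single ⟨m, by omega⟩ 1 + Pi.single ⟨m + 1, by omega⟩ 1)

theorem isEdgeVec_dmkEdge (m k : ℕ) (s : Fin m ⊕ Fin k) : IsEdgeVec (dmkEdge m k s) := by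
  rcases s with i | j
  · exact ⟨_, _, by simp, rfl⟩
  · exact ⟨_, _, by simp, rfl⟩

theorem dmkEdge_dotProduct_eq_one_iff (m k : ℕ) (s t : Fin m ⊕ Fin k) :
    dmkEdge m k s ⬝ᵥ dmkEdge m k t = 1 ↔ (DmkGraph m k).Adj s t := by
  have h11 : (1 : ZMod 2) + 1 = 0 := rfl
  rcases s with ⟨i, hi⟩ | j <;> rcases t with ⟨i', hi'⟩ | j' <;>
    simp only [dmkEdge, Sum.elim_inl, Sum.elim_inr, single_add_single_dotProduct, Pi.add_apply,
      Pi.single_apply, Fin.mk.injEq, DmkGraph, SimpleGraph.fromRel_adj, ne_eq, Sum.inl.injEq,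
      reduceCtorEq, not_false_eq_true, true_and, or_false, false_or, and_false, iff_false]
  · rcases lt_trichotomy i i' with h | rfl | h
    · by_cases h' : i + 1 = i'
      · subst h'; simp [add_assoc]
      · simp [show i ≠ i' by omega, show i ≠ i' + 1 by omega, h', show i' + 1 ≠ i by omega]
    · simp [h11]
    · by_cases h' : i' + 1 = i
      · subst h'; simp [add_assoc]
      · simp [show i ≠ i' by omega, show i + 1 ≠ i' by omega, h', show i ≠ i' + 1 by omega]
  · by_cases h' : i + 1 = m
    · simp [h', show i ≠ m by omega, show i ≠ m + 1 by omega]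
    · simp [h', show i ≠ m by omega, show i ≠ m + 1 by omega]
  · by_cases h' : i' + 1 = m
    · simp [h', show m ≠ i' by omega, show m + 1 ≠ i' by omega]
    · simp [show ¬ m = i' + 1 by omega, show m ≠ i' by omega, show m + 1 ≠ i' by omega, h']
  · simp [h11]

theorem form_symm_of_alternating {Ω : BForm V} (hΩ : ∀ v : V, Ω v v = 0) (x y : V) :
    Ω x y = Ω y x := by
  have h := hΩ (x + y)
  simp only [map_add, LinearMap.add_apply, hΩ, zero_add, add_zero] at h
  rw [← sub_eq_zero, CharTwo.sub_eq_add, add_comm]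
  exact h

theorem exists_isEdgeRep_of_dmk {Ω : BForm V} (hΩ : ∀ v : V, Ω v v = 0) {B : Set V}
    (hB : IsBasisSet B) {m k : ℕ} (e : Gr Ω B ≃g DmkGraph m k) :
    ∃ π : V →ₗ[ZMod 2] (Fin (m + 2) → ZMod 2), IsEdgeRep Ω B π := by
  let b : Module.Basis B (ZMod 2) V := Module.Basis.mk hB.1 (by simp [hB.2])
  have hb : ∀ i, b i = i.1 := fun i => by simp [b]
  let π : V →ₗ[ZMod 2] (Fin (m + 2) → ZMod 2) := b.constr (ZMod 2) fun i => dmkEdge m k (e i)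
  have hπ : ∀ i : B, π i.1 = dmkEdge m k (e i) := fun i => by
    rw [← hb i]; exact b.constr_basis _ _ _
  refine ⟨π, fun x y => ?_, fun c hc => ?_⟩
  · have hD : Ω = (dotProductBilin (ZMod 2) (ZMod 2)).compl₁₂ π π := by
      refine b.ext fun i => b.ext fun j => ?_
      have h1 : Ω i.1 j.1 = 1 ↔ π i.1 ⬝ᵥ π j.1 = 1 := by
        rw [hπ, hπ, dmkEdge_dotProduct_eq_one_iff, e.map_adj_iff, Gr, SimpleGraph.fromRel_adj,
          form_symm_of_alternating hΩ j.1 i.1, or_self]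
        refine ⟨fun h => ⟨?_, h⟩, fun h => h.2⟩
        rintro rfl
        simp [hΩ] at h
      simp only [hb, LinearMap.compl₁₂_apply]
      change Ω i.1 j.1 = π i.1 ⬝ᵥ π j.1
      rcases zmod_two_eq_zero_or_one (Ω i.1 j.1) with h | h
      · rcases zmod_two_eq_zero_or_one (π i.1 ⬝ᵥ π j.1) with h' | h'
        · rw [h, h']
        · rw [h1.2 h', h']
      · rw [h, h1.1 h]
    exact congrArg (fun F : BForm V => F x y) hD
  · rw [hπ ⟨c, hc⟩]
    exact isEdgeVec_dmkEdge m k _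

theorem IsBasisSet.of_moveRel {Ω : BForm V} {B B' : Set V} (hB : IsBasisSet B)
    (h : MoveRel Ω B B') : IsBasisSet B' := by
  obtain ⟨a, c, ha, hc, hac, -, rfl⟩ := h
  have haB : a ∈ Submodule.span (ZMod 2) (B \ {c}) := Submodule.subset_span ⟨ha, hac⟩
  have hBc : insert c (B \ {c}) = B := by rw [Set.insert_sdiff_singleton, Set.insert_eq_of_mem hc]
  constructor
  · have hli : LinearIndepOn (ZMod 2) id (insert c (B \ {c})) := by rw [hBc]; exact hB.1
    rw [linearIndepOn_id_insert (by simp)] at hli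
    refine hli.1.id_insert fun hmem => hli.2 ?_
    simpa using Submodule.sub_mem _ hmem haB
  · rw [eq_top_iff, ← hB.2, Submodule.span_le]
    have hsub : Submodule.span (ZMod 2) (B \ {c}) ≤
        Submodule.span (ZMod 2) (insert (c + a) (B \ {c})) :=
      Submodule.span_mono (Set.subset_insert _ _)
    intro z hz
    by_cases hzc : z = c
    · subst hzc
      have := Submodule.sub_mem _ (Submodule.subset_span (Set.mem_insert (z + a) (B \ {z})))
        (hsub haB)
      simpa using this
    · exact hsub (Submodule.subset_span ⟨hz, hzc⟩)

section Rep

variable {ι : Type*} [Fintype ι] [DecidableEq ι] {Ω : BForm V} {B : Set V}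
  {π : V →ₗ[ZMod 2] (ι → ZMod 2)}

theorem IsEdgeRep.of_moveRel {B' : Set V} (hΩ : ∀ v : V, Ω v v = 0) (hπ : IsEdgeRep Ω B' π)
    (h : MoveRel Ω B B') : IsEdgeRep Ω B π := by
  obtain ⟨a, c, ha, hc, hac, h1, rfl⟩ := h
  refine ⟨hπ.1, fun z hz => ?_⟩
  by_cases hzc : z = c
  · subst hzc
    have hsum := (hπ.2 _ (Set.mem_insert _ _)).add
      (hπ.2 a (Set.mem_insert_of_mem _ ⟨ha, hac⟩)) (by
        rw [← hπ.1, form_symm_of_alternating hΩ, map_add, h1, hΩ, add_zero])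
    rwa [← map_add, add_assoc, zmod_two_add_self, add_zero] at hsum
  · exact hπ.2 z (Set.mem_insert_of_mem _ ⟨hz, hzc⟩)

theorem IsEdgeRep.isEdgeVec_of_mem_delta (hπ : IsEdgeRep Ω B π) {x : V} (hx : x ∈ Delta Ω B) :
    IsEdgeVec (π x) := by
  obtain ⟨b, hb, g, hg, rfl⟩ := hx
  suffices h : ∀ z, IsEdgeVec (π z) ↔ IsEdgeVec (π (g z)) from (h b).1 (hπ.2 b hb)
  induction hg using Subgroup.closure_induction with
  | mem g hg =>
    obtain ⟨c, hc, hg⟩ := hg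
    have hcc : Ω c c = 0 := by
      obtain ⟨p, q, hpq, h⟩ := hπ.2 c hc
      rw [hπ.1, h, single_add_single_dotProduct]
      simp [hpq, hpq.symm]
      rfl
    have hstep : ∀ z, IsEdgeVec (π z) → IsEdgeVec (π (g z)) := by
      intro z hz
      rw [hg]
      rcases zmod_two_eq_zero_or_one (Ω z c) with h | h
      · simpa [h] using hz
      · rw [h, one_smul, map_add]
        exact hz.add (hπ.2 c hc) (by rw [← hπ.1, h])
    refine fun z => ⟨hstep z, fun h => ?_⟩
    have hinv : g (g z) = z := by
      rw [hg (g z), hg z]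
      simp only [map_add, map_smul, LinearMap.add_apply, LinearMap.smul_apply, hcc, smul_zero,
        add_zero, add_assoc, zmod_two_add_self]
    exact hinv ▸ hstep _ h
  | one => simp
  | mul g h _ _ ihg ihh => exact fun z => (ihh z).trans (ihg (h z))
  | inv g _ ih => exact fun z => by simpa using (ih (g⁻¹ z)).symm

end Rep

theorem add_mem_delta {Ω : BForm V} (hΩ : ∀ v : V, Ω v v = 0) {B : Set V} {x b : V}
    (hx : x ∈ Delta Ω B) (hb : b ∈ B) (h : Ω x b = 1) : x + b ∈ Delta Ω B := by
  obtain ⟨c, hc, g, hg, rfl⟩ := hx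
  let T : V →ₗ[ZMod 2] V := LinearMap.id + (Ω.flip b).smulRight b
  have hT : ∀ z, T z = z + Ω z b • b := fun z => rfl
  have hinv : Function.Involutive T := fun z => by
    simp only [hT, map_add, map_smul, LinearMap.add_apply, LinearMap.smul_apply, hΩ, smul_zero,
      add_zero, add_assoc, zmod_two_add_self]
  refine ⟨c, hc, LinearEquiv.ofInvolutive T hinv * g,
    mul_mem (Subgroup.subset_closure ⟨b, hb, fun z => hT z⟩) hg, ?_⟩
  change T (g c) = _
  rw [hT, h, one_smul]

theorem mem_delta_of_mem {Ω : BForm V} {B : Set V} {b : V} (hb : b ∈ B) : b ∈ Delta Ω B :=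
  ⟨b, hb, 1, one_mem _, rfl⟩

/-- Partial sums along an induced path in `Gr(B)` lie in `Δ`. -/
theorem sum_range_mem_delta {Ω : BForm V} (hΩ : ∀ v : V, Ω v v = 0) {B : Set V} {f : ℕ → V}
    (hf : ∀ i, f i ∈ B) {l : ℕ}
    (hadj : ∀ i j, i < j → j ≤ l → Ω (f i) (f j) = if j = i + 1 then 1 else 0) :
    ∑ i ∈ Finset.range (l + 1), f i ∈ Delta Ω B := by
  suffices h : ∀ j ≤ l, ∑ i ∈ Finset.range (j + 1), f i ∈ Delta Ω B from h l le_rfl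
  intro j
  induction j with
  | zero => exact fun _ => by simpa using mem_delta_of_mem (hf 0)
  | succ j ih =>
    intro hj
    rw [Finset.sum_range_succ]
    refine add_mem_delta hΩ (ih (by omega)) (hf _) ?_
    rw [map_sum, LinearMap.sum_apply, Finset.sum_eq_single_of_mem j (by simp)]
    · rw [hadj _ _ (by omega) hj, if_pos rfl]
    · intro i hi hij
      rw [hadj _ _ (by simp at hi; omega) hj, if_neg (by omega)]

theorem exists_isEdgeRep_of_equivToDmkTree {Ω : BForm V} (hΩ : ∀ v : V, Ω v v = 0) {B : Set V}
    (hB : IsBasisSet B) {m k : ℕ} (h : EquivToDmkTree Ω B m k) :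
    ∃ π : V →ₗ[ZMod 2] (Fin (m + 2) → ZMod 2), IsEdgeRep Ω B π := by
  obtain ⟨B', hBB', ⟨e⟩⟩ := h
  induction hBB' using Relation.ReflTransGen.head_induction_on with
  | refl => exact exists_isEdgeRep_of_dmk hΩ hB e
  | head hmove _ ih =>
    obtain ⟨π, hπ⟩ := ih (hB.of_moveRel hmove)
    exact ⟨π, hπ.of_moveRel hΩ hmove⟩

/-- Let `B` be a basis equivalent to a basis whose graph is a tree of type
`D_{m,k}` (`m ≥ 2`, `k ≥ 1`). If `x₁, …, x_r ∈ B` (`r ≥ 5`) induce a cycle of length `r`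
in `Gr(B)`, then `span{x₁,…,x_r} ∩ V₀₀₀` is the subspace spanned by `x₁ + ⋯ + x_r`. -/
theorem stmt_6 {V : Type*} [AddCommGroup V] [Module (ZMod 2) V]
    [FiniteDimensional (ZMod 2) V]
    (Ω : BForm V) (hΩ : ∀ v : V, Ω v v = 0)
    (B : Set V) (hB : IsBasisSet B)
    (m k : ℕ) (hm : 2 ≤ m) (hk : 1 ≤ k) (hequiv : EquivToDmkTree Ω B m k)
    (r : ℕ) (hr : 5 ≤ r) (x : Fin r → V) (hinj : Function.Injective x)
    (hxB : Set.range x ⊆ B)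
    (hcycle : ∀ i j : Fin r,
      Ω (x i) (x j) = 1 ↔ (j.val = (i.val + 1) % r ∨ i.val = (j.val + 1) % r)) :
    (Submodule.span (ZMod 2) (Set.range x) : Set V) ∩ V000set Ω B =
      (Submodule.span (ZMod 2) {∑ i, x i} : Set V) := by
  obtain ⟨π, hπ⟩ := exists_isEdgeRep_of_equivToDmkTree hΩ hB hequiv
  obtain ⟨n, rfl⟩ : ∃ n, r = n + 5 := ⟨r - 5, by omega⟩
  have hxmem : ∀ i, x i ∈ B := fun i => hxB ⟨i, rfl⟩
  have hadj : ∀ i j, Ω (x i) (x j) = 1 ↔ (j = i + 1 ∨ i = j + 1) := by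
    intro i j
    rw [hcycle, Fin.ext_iff, Fin.ext_iff, Fin.val_add, Fin.val_add]
    simp
  obtain ⟨v, hvinj, hv⟩ := exists_cycle_vertices (u := fun i => π (x i))
    (fun i => hπ.2 _ (hxmem i)) (fun i j => by rw [← hπ.1, hadj])
  have hcomb : ∀ s : Fin (n + 5) → ZMod 2,
      π (∑ i, s i • x i) = ∑ i, (s i + s (i + 1)) • Pi.single (v i) 1 := by
    intro s
    simp only [map_sum, map_smul, hv, smul_add, add_smul, Finset.sum_add_distrib]
    refine (add_comm _ _).trans (congrArg _ ?_)
    rw [← Equiv.sum_comp (Equiv.addRight (1 : Fin (n + 5)))]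
    simp
  have hsum0 : π (∑ i, x i) = 0 := by
    have h := hcomb 1
    simpa [zmod_two_add_self] using h
  have hV000 : ∑ i, x i ∈ V000set Ω B := by
    refine ⟨fun w => by rw [hπ.1, hsum0, zero_dotProduct], ?_⟩
    let f : ℕ → V := fun i => x (Fin.ofNat (n + 5) i)
    refine ⟨_, sum_range_mem_delta (f := f) (l := n + 3) hΩ (fun i => hxmem _) ?_,
      f (n + 4), mem_delta_of_mem (hxmem _), ?_⟩
    · intro i j hij hj
      have hiff := hcycle (Fin.ofNat (n + 5) i) (Fin.ofNat (n + 5) j)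
      simp only [Fin.val_ofNat, Nat.mod_eq_of_lt (show i < n + 5 by omega),
        Nat.mod_eq_of_lt (show j < n + 5 by omega), Nat.mod_eq_of_lt (show i + 1 < n + 5 by omega),
        Nat.mod_eq_of_lt (show j + 1 < n + 5 by omega)] at hiff
      split_ifs with h
      · exact hiff.2 (Or.inl h)
      · rcases zmod_two_eq_zero_or_one (Ω (f i) (f j)) with h' | h'
        · exact h'
        · have := hiff.1 h'
          omega
    · rw [← Finset.sum_range_succ, Finset.sum_range]
      refine Finset.sum_congr rfl fun i _ => ?_
      simp [f]
  ext y
  simp only [Set.mem_inter_iff, SetLike.mem_coe, Submodule.mem_span_singleton]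
  constructor
  · rintro ⟨hy, hy0, d₁, hd₁, d₂, hd₂, hyd⟩
    obtain ⟨s, rfl⟩ := (Submodule.mem_span_range_iff_exists_fun (ZMod 2)).1 hy
    have hval : ∀ i, π (∑ i, s i • x i) (v i) = s i + s (i + 1) := by
      intro i
      rw [hcomb, Finset.sum_apply, Finset.sum_eq_single i]
      · simp
      · intro j _ hj
        simp [hvinj.ne hj.symm]
      · simp
    have hstep : ∀ i, s (i + 1) + s (i + 1 + 1) = s i + s (i + 1) := by
      intro i
      have h := hy0 (x (i + 1))
      rw [hπ.1, dotProduct_comm, hv, single_add_single_dotProduct, hval, hval,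
        add_sub_cancel_right] at h
      rw [← sub_eq_zero, CharTwo.sub_eq_add, add_comm]
      exact h
    have hconst : ∀ i, s i + s (i + 1) = s 0 + s 1 := by
      intro i
      induction i using Fin.induction with
      | zero => simp
      | succ i ih => rw [← Fin.coeSucc_eq_succ, hstep, ih]
    rcases zmod_two_eq_zero_or_one (s 0 + s 1) with h | h
    · have hs : ∀ i, s i = s 0 := by
        intro i
        induction i using Fin.induction with
        | zero => rfl
        | succ i ih =>
          rw [← Fin.coeSucc_eq_succ, ← ih]
          have := hconst i.castSucc
          rw [h, ← CharTwo.sub_eq_add, sub_eq_zero] at this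
          exact this.symm
      exact ⟨s 0, by rw [Finset.smul_sum]; exact Finset.sum_congr rfl fun i _ => by rw [hs i]⟩
    · have := IsEdgeVec.card_le_of_add hvinj (hπ.isEdgeVec_of_mem_delta hd₁)
        (hπ.isEdgeVec_of_mem_delta hd₂) fun i => by rw [← map_add, ← hyd, hval, hconst, h]
      omega
  · rintro ⟨t, rfl⟩
    refine ⟨Submodule.smul_mem _ _ (Submodule.sum_mem _ fun i _ =>
      Submodule.subset_span ⟨i, rfl⟩), ?_⟩
    rcases zmod_two_eq_zero_or_one t with rfl | rfl
    · rw [zero_smul]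
      exact ⟨fun w => by simp, x 0, mem_delta_of_mem (hxmem 0), x 0, mem_delta_of_mem (hxmem 0),
        (zmod_two_add_self _).symm⟩
    · rwa [one_smul]
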